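/- There is C > 0 such that for all u, z : ℤ → [0,∞) with ‖u‖_{ℓ²}, ‖z‖_{ℓ²} < ∞: ∑_{k∈ℤ} ∑_{k₁+k₂+k₃=k, Φ(k̄)≠0} M₄ · u(k₁) u(k₂) u(k₃) z(k) ≤ C ‖u‖³_{ℓ²} ‖z‖_{ℓ²}, where M₄ := |k| ⟨k⟩^{1/2} ⟨k₁⟩^{1/2} / (|Φ(k̄)| ⟨k₂⟩^{1/2} ⟨k₃⟩^{1/2}). -/

import Mathlib

open scoped ENNReal

/-- Japanese bracket `⟨k⟩ = 1 + |k|`. -/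
noncomputable def jb (k : ℤ) : ℝ := 1 + |(k : ℝ)|

/-- `‖u‖_{ℓ²} = (∑_k u(k)²)^{1/2}`, valued in `[0,∞]`. -/
noncomputable def l2 (u : ℤ → ℝ) : ℝ≥0∞ :=
  (∑' k : ℤ, ENNReal.ofReal (u k ^ 2)) ^ (1 / 2 : ℝ)

/-- `Φ(k̄) = k³ − k₁³ − k₂³ − k₃³` with `k = k₁ + k₂ + k₃`. -/
def Phi (k₁ k₂ k₃ : ℤ) : ℤ := (k₁ + k₂ + k₃) ^ 3 - k₁ ^ 3 - k₂ ^ 3 - k₃ ^ 3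

/-- The multiplier `M₄ = |k| ⟨k⟩^{1/2} ⟨k₁⟩^{1/2} / (|Φ(k̄)| ⟨k₂⟩^{1/2} ⟨k₃⟩^{1/2})`. -/
noncomputable def M4 (k₁ k₂ k₃ : ℤ) : ℝ :=
  |((k₁ + k₂ + k₃ : ℤ) : ℝ)| * jb (k₁ + k₂ + k₃) ^ (1 / 2 : ℝ) * jb k₁ ^ (1 / 2 : ℝ) /
    (|((Phi k₁ k₂ k₃ : ℤ) : ℝ)| * jb k₂ ^ (1 / 2 : ℝ) * jb k₃ ^ (1 / 2 : ℝ))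

lemma M4_eq_sqrt (a b c : ℤ) :
    M4 a b c = |((a + b + c : ℤ) : ℝ)| * √(jb (a + b + c)) * √(jb a) /
      (|((Phi a b c : ℤ) : ℝ)| * √(jb b) * √(jb c)) := by
  simp only [M4, Real.sqrt_eq_rpow]

lemma M4_comm (a b c : ℤ) : M4 a b c = M4 a c b := by
  have h : Phi a b c = Phi a c b := by simp only [Phi]; ring
  rw [M4, M4, h, add_right_comm a b c]
  ring

lemma Phi_eq_mul (a b c : ℤ) : Phi a b c = 3 * ((b + c) * (a + c) * (a + b)) := by
  simp only [Phi]; ring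

lemma rpow_neg_three_halves {x : ℝ} (hx : 0 < x) : x ^ (-(3 / 2) : ℝ) = 1 / (x * √x) := by
  rw [Real.rpow_neg hx.le, one_div, Real.sqrt_eq_rpow, ← Real.rpow_one_add' hx.le (by norm_num)]
  norm_num

lemma one_div_sq_le_rpow {x : ℝ} (hx : 1 ≤ x) : 1 / x ^ 2 ≤ x ^ (-(3 / 2) : ℝ) := by
  rw [rpow_neg_three_halves (by linarith)]
  have h : √x ≤ x := Real.sqrt_le_iff.2 ⟨by linarith, by nlinarith⟩
  have : 0 < √x := Real.sqrt_pos.2 (by linarith)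
  apply one_div_le_one_div_of_le <;> nlinarith

lemma one_div_mul_le_rpow_add {x y : ℝ} (hx : 1 ≤ x) (hy : 1 ≤ y) :
    1 / (x * y) ≤ (x ^ (-(3 / 2) : ℝ) + y ^ (-(3 / 2) : ℝ)) / 2 := by
  have h1 := one_div_sq_le_rpow hx
  have h2 := one_div_sq_le_rpow hy
  have h3 := sq_nonneg (1 / x - 1 / y)
  have h4 : (1 / x - 1 / y) ^ 2 = 1 / x ^ 2 + 1 / y ^ 2 - 2 * (1 / (x * y)) := by
    field_simp
    ring
  linarith

lemma one_div_mul_sqrt_le_rpow_add {x y : ℝ} (hx : 0 < x) (hy : 0 < y) :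
    1 / (x * √y) ≤ x ^ (-(3 / 2) : ℝ) + y ^ (-(3 / 2) : ℝ) := by
  have hx' : 0 ≤ x ^ (-(3 / 2) : ℝ) := Real.rpow_nonneg hx.le _
  have hy' : 0 ≤ y ^ (-(3 / 2) : ℝ) := Real.rpow_nonneg hy.le _
  have hsx : 0 < √x := Real.sqrt_pos.2 hx
  have hsy : 0 < √y := Real.sqrt_pos.2 hy
  rcases le_total x y with h | h
  · have : 1 / (x * √y) ≤ x ^ (-(3 / 2) : ℝ) := by
      rw [rpow_neg_three_halves hx]
      gcongr
    linarith
  · have : 1 / (x * √y) ≤ y ^ (-(3 / 2) : ℝ) := by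
      rw [rpow_neg_three_halves hy]
      gcongr
    linarith

lemma multiplier_le_of_mul_le {κ K h p q x y t : ℝ} (hp : 0 < p)
    (hq : 0 < q) (hx : 1 ≤ x) (hy : 1 ≤ y) (ht : 1 ≤ t) (hK : 0 ≤ K)
    (hsum : 2 * κ ≤ x + y + t) (hle : K * h ≤ 16 * (p * q)) :
    κ * √K * √h / (3 * (x * y * t) * √p * √q) ≤
      4 * (x ^ (-(3 / 2) : ℝ) + y ^ (-(3 / 2) : ℝ) + t ^ (-(3 / 2) : ℝ)) := by
  have hs : √K * √h ≤ 4 * (√p * √q) := by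
    rw [← Real.sqrt_mul hK, ← Real.sqrt_mul hp.le, Real.sqrt_le_iff]
    refine ⟨by positivity, ?_⟩
    rw [mul_pow, Real.sq_sqrt (by positivity)]
    linarith
  have hxy := one_div_mul_le_rpow_add hx hy
  have hxt := one_div_mul_le_rpow_add hx ht
  have hyt := one_div_mul_le_rpow_add hy ht
  have hsp : 0 < √p := Real.sqrt_pos.2 hp
  have hsq : 0 < √q := Real.sqrt_pos.2 hq
  calc κ * √K * √h / (3 * (x * y * t) * √p * √q)
      = κ * (√K * √h) / (3 * (x * y * t) * √p * √q) := by ring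
    _ ≤ ((x + y + t) / 2) * (4 * (√p * √q)) / (3 * (x * y * t) * √p * √q) := by
        gcongr
        linarith
    _ = 2 / 3 * (1 / (x * y) + 1 / (x * t) + 1 / (y * t)) := by
        field_simp
        ring
    _ ≤ _ := by
        have := one_div_pos.2 (show 0 < x * y by positivity)
        have := one_div_pos.2 (show 0 < x * t by positivity)
        have := one_div_pos.2 (show 0 < y * t by positivity)
        linarith

lemma multiplier_le_of_large_output {κ K h p q x y t : ℝ} (hκ : 0 < κ) (hp : 0 < p)
    (hx : 0 < x) (hK : 0 ≤ K) (hKκ : K ≤ 2 * κ) (hh : h ≤ 2 * K) (hy : κ ≤ 2 * y)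
    (ht : κ ≤ 2 * t) (hpq : x ≤ p * q) :
    κ * √K * √h / (3 * (x * y * t) * √p * √q) ≤ 4 * x ^ (-(3 / 2) : ℝ) := by
  have hs : √K * √h ≤ 3 * κ := by
    rw [← Real.sqrt_mul hK, Real.sqrt_le_iff]
    exact ⟨by positivity, by nlinarith⟩
  have hx2 : √x ≤ √p * √q := by
    rw [← Real.sqrt_mul hp.le]
    exact Real.sqrt_le_sqrt hpq
  have hsx : 0 < √x := Real.sqrt_pos.2 hx
  have hy0 : 0 < y := by linarith
  have ht0 : 0 < t := by linarith
  calc κ * √K * √h / (3 * (x * y * t) * √p * √q)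
      = κ * (√K * √h) / (3 * (x * (y * t)) * (√p * √q)) := by ring
    _ ≤ κ * (3 * κ) / (3 * (x * (κ / 2 * (κ / 2))) * √x) := by
        gcongr <;> linarith
    _ = 4 * x ^ (-(3 / 2) : ℝ) := by
        rw [rpow_neg_three_halves hx]
        field_simp
        norm_num

lemma multiplier_le_of_large_input {κ K h p q x y t : ℝ} (hp : 0 < p)
    (hq : 0 < q) (hx : 0 < x) (hy : 0 < y) (hκK : κ ≤ K) (hK : 0 < K) (hh : 0 < h)
    (hhy : h ≤ 2 * y) (hKt : K ≤ 2 * t) (hKp : K ≤ 2 * p) (hyq : y ≤ q * h) :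
    κ * √K * √h / (3 * (x * y * t) * √p * √q) ≤
      4 * (x ^ (-(3 / 2) : ℝ) + y ^ (-(3 / 2) : ℝ)) := by
  have hs : √K ≤ 2 * √p := by
    rw [Real.sqrt_le_iff]
    refine ⟨by positivity, ?_⟩
    rw [mul_pow, Real.sq_sqrt hp.le]
    linarith
  have hy2 : √y ≤ √q * √h := by
    rw [← Real.sqrt_mul hq.le]
    exact Real.sqrt_le_sqrt hyq
  have hsp : 0 < √p := Real.sqrt_pos.2 hp
  have hsq : 0 < √q := Real.sqrt_pos.2 hq
  have hsh : 0 < √h := Real.sqrt_pos.2 hh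
  have hsy : 0 < √y := Real.sqrt_pos.2 hy
  calc κ * √K * √h / (3 * (x * y * t) * √p * √q)
      ≤ K * (2 * √p) * √h / (3 * (x * (h / 2) * (K / 2)) * √p * √q) := by
        gcongr <;> linarith
    _ = 8 / 3 * (1 / (x * (√q * √h))) := by
        have : √h * √h = h := Real.mul_self_sqrt hh.le
        field_simp
        nlinarith
    _ ≤ 8 / 3 * (1 / (x * √y)) := by gcongr
    _ ≤ _ := by
        have := one_div_mul_sqrt_le_rpow_add hx hy
        have : 0 < 1 / (x * √y) := by positivity
        linarith

lemma jb_eq (k : ℤ) : jb k = 1 + |(k : ℝ)| := rfl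

lemma jb_pos (k : ℤ) : 0 < jb k := by rw [jb]; positivity

lemma abs_add_le_jb_mul (a b : ℤ) : |((a + b : ℤ) : ℝ)| ≤ jb a * jb b := by
  have := abs_add_le (a : ℝ) b
  have := mul_nonneg (abs_nonneg (a : ℝ)) (abs_nonneg (b : ℝ))
  push_cast
  rw [jb, jb]
  nlinarith

lemma one_le_abs_intCast {n : ℤ} (hn : n ≠ 0) : 1 ≤ |(n : ℝ)| := by
  exact_mod_cast Int.one_le_abs hn

lemma M4_le_of_abs_le {a b c : ℤ} (hΦ : Phi a b c ≠ 0) (hcb : |(c : ℝ)| ≤ |(b : ℝ)|) :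
    M4 a b c ≤ 4 * (|((b + c : ℤ) : ℝ)| ^ (-(3 / 2) : ℝ) + |((a + c : ℤ) : ℝ)| ^ (-(3 / 2) : ℝ)
      + |((a + b : ℤ) : ℝ)| ^ (-(3 / 2) : ℝ)) := by
  have hne : b + c ≠ 0 ∧ a + c ≠ 0 ∧ a + b ≠ 0 := by
    rw [Phi_eq_mul] at hΦ
    refine ⟨?_, ?_, ?_⟩ <;> rintro h <;> simp [h] at hΦ
  obtain ⟨hA, hB, hC⟩ := hne
  have hx := one_le_abs_intCast hA
  have hy := one_le_abs_intCast hB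
  have ht := one_le_abs_intCast hC
  have hwx := Real.rpow_nonneg (abs_nonneg ((b + c : ℤ) : ℝ)) (-(3 / 2))
  have hwy := Real.rpow_nonneg (abs_nonneg ((a + c : ℤ) : ℝ)) (-(3 / 2))
  have hwt := Real.rpow_nonneg (abs_nonneg ((a + b : ℤ) : ℝ)) (-(3 / 2))
  have hPhi : |((Phi a b c : ℤ) : ℝ)| =
      3 * (|((b + c : ℤ) : ℝ)| * |((a + c : ℤ) : ℝ)| * |((a + b : ℤ) : ℝ)|) := by
    rw [Phi_eq_mul, Int.cast_mul, Int.cast_mul, Int.cast_mul, abs_mul, abs_mul, abs_mul]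
    norm_num
  rw [M4_eq_sqrt, hPhi]
  have hpq := abs_add_le_jb_mul b c
  have hqh := abs_add_le_jb_mul c a
  rw [add_comm c a] at hqh
  rcases eq_or_ne (a + b + c) 0 with h0 | h0
  · rw [h0]
    simp only [Int.cast_zero, abs_zero, zero_mul, zero_div]
    positivity
  have hκ := one_le_abs_intCast h0
  have hsum : 2 * |((a + b + c : ℤ) : ℝ)| ≤
      |((b + c : ℤ) : ℝ)| + |((a + c : ℤ) : ℝ)| + |((a + b : ℤ) : ℝ)| := by
    push_cast
    grind
  by_cases hle : jb (a + b + c) * jb a ≤ 16 * (jb b * jb c)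
  · exact multiplier_le_of_mul_le (jb_pos b) (jb_pos c) hx hy ht (jb_pos _).le
      hsum hle
  have hyκ : |((a + b + c : ℤ) : ℝ)| ≤ |((a + c : ℤ) : ℝ)| + |(b : ℝ)| := by push_cast; grind
  have htκ : |((a + b + c : ℤ) : ℝ)| ≤ |((a + b : ℤ) : ℝ)| + |(c : ℝ)| := by push_cast; grind
  have haκ : |(a : ℝ)| ≤ |((a + b + c : ℤ) : ℝ)| + |(b : ℝ)| + |(c : ℝ)| := by push_cast; grind
  have hay : |(a : ℝ)| ≤ |((a + c : ℤ) : ℝ)| + |(c : ℝ)| := by push_cast; grind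
  by_cases hbig : 2 * |(b : ℝ)| ≤ |((a + b + c : ℤ) : ℝ)|
  · refine (multiplier_le_of_large_output (by linarith) (jb_pos b) (by linarith) (jb_pos _).le
      ?_ ?_ ?_ ?_ hpq).trans (by linarith)
    · rw [jb_eq]; linarith
    · rw [jb_eq, jb_eq]; linarith
    · linarith
    · linarith
  · have hKb : jb (a + b + c) ≤ 2 * jb b := by rw [jb_eq, jb_eq]; linarith
    have hab : jb a ≤ 4 * jb b := by rw [jb_eq, jb_eq]; linarith
    have hb := jb_pos b
    have hac : 8 * jb c ≤ jb a := by
      by_contra! h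
      exact hle (by nlinarith [jb_pos a])
    have hKc : 4 * jb c ≤ jb (a + b + c) := by
      by_contra! h
      exact hle (by nlinarith [jb_pos a, jb_pos (a + b + c), jb_pos c])
    refine (multiplier_le_of_large_input hb (jb_pos c) (by linarith)
      (by linarith) ?_ (jb_pos _) (jb_pos a) ?_ ?_ hKb hqh).trans (by linarith)
    · rw [jb_eq]; linarith
    · rw [jb_eq, jb_eq] at hac; rw [jb_eq]; linarith [abs_nonneg (c : ℝ)]
    · rw [jb_eq, jb_eq] at hKc; rw [jb_eq]; linarith [abs_nonneg (c : ℝ)]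

lemma M4_le {a b c : ℤ} (hΦ : Phi a b c ≠ 0) :
    M4 a b c ≤ 4 * (|((b + c : ℤ) : ℝ)| ^ (-(3 / 2) : ℝ) + |((a + c : ℤ) : ℝ)| ^ (-(3 / 2) : ℝ)
      + |((a + b : ℤ) : ℝ)| ^ (-(3 / 2) : ℝ)) := by
  rcases le_total |(c : ℝ)| |(b : ℝ)| with h | h
  · exact M4_le_of_abs_le hΦ h
  · have hΦ' : Phi a c b ≠ 0 := by rwa [Phi_eq_mul, add_comm c b, mul_right_comm, ← Phi_eq_mul]
    have := M4_le_of_abs_le hΦ' h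
    rw [M4_comm, add_comm b c]
    linarith

lemma ENNReal.tsum_mul_le_sqrt_mul_sqrt {ι : Type*} (f g : ι → ℝ≥0∞) :
    ∑' i, f i * g i ≤ (∑' i, f i ^ 2) ^ (1 / 2 : ℝ) * (∑' i, g i ^ 2) ^ (1 / 2 : ℝ) := by
  rw [ENNReal.tsum_eq_iSup_sum]
  refine iSup_le fun s => (ENNReal.inner_le_Lp_mul_Lq s f g Real.HolderConjugate.two_two).trans ?_
  simp only [ENNReal.rpow_two]
  gcongr <;> exact ENNReal.sum_le_tsum s

/-- Young-type trilinear bound, with the weight carried by the sum of two input frequencies. -/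
lemma tsum_weight_mul_le (w f g : ℤ → ℝ≥0∞) :
    ∑' (a : ℤ) (b : ℤ) (c : ℤ), w (b + c) * (f a * f b * f c * g (a + b + c)) ≤
      (∑' n, w n) * ((∑' n, f n ^ 2) ^ (1 / 2 : ℝ)) ^ 3 * (∑' n, g n ^ 2) ^ (1 / 2 : ℝ) := by
  set F := (∑' n, f n ^ 2) ^ (1 / 2 : ℝ)
  set G := (∑' n, g n ^ 2) ^ (1 / 2 : ℝ)
  have hout : ∀ n, ∑' a, f a * g (a + n) ≤ F * G := fun n => by
    refine (ENNReal.tsum_mul_le_sqrt_mul_sqrt _ _).trans_eq ?_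
    exact congrArg (F * · ^ (1 / 2 : ℝ)) ((Equiv.addRight n).tsum_eq fun k => g k ^ 2)
  have hin : ∀ n, ∑' b, f b * f (n - b) ≤ F * F := fun n => by
    refine (ENNReal.tsum_mul_le_sqrt_mul_sqrt _ _).trans_eq ?_
    exact congrArg (F * · ^ (1 / 2 : ℝ)) ((Equiv.subLeft n).tsum_eq fun k => f k ^ 2)
  calc ∑' (a : ℤ) (b : ℤ) (c : ℤ), w (b + c) * (f a * f b * f c * g (a + b + c))
      = ∑' (b : ℤ) (c : ℤ) (a : ℤ), w (b + c) * (f b * f c) * (f a * g (a + (b + c))) := by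
        rw [ENNReal.tsum_comm]
        refine tsum_congr fun b => ?_
        rw [ENNReal.tsum_comm]
        refine tsum_congr fun c => tsum_congr fun a => ?_
        rw [add_assoc]
        ring
    _ ≤ ∑' (b : ℤ) (c : ℤ), w (b + c) * (f b * f c) * (F * G) := by
        refine ENNReal.tsum_le_tsum fun b => ENNReal.tsum_le_tsum fun c => ?_
        rw [ENNReal.tsum_mul_left]
        gcongr
        exact hout _
    _ = ∑' (b : ℤ) (n : ℤ), w n * (f b * f (n - b)) * (F * G) := by
        refine tsum_congr fun b => ?_
        rw [← (Equiv.addLeft b).tsum_eq fun n => w n * (f b * f (n - b)) * (F * G)]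
        simp
    _ = (∑' n, w n * ∑' b, f b * f (n - b)) * (F * G) := by
        rw [ENNReal.tsum_comm]
        simp only [ENNReal.tsum_mul_right, ENNReal.tsum_mul_left]
    _ ≤ (∑' n, w n * (F * F)) * (F * G) := by
        gcongr with n
        exact hin n
    _ = (∑' n, w n) * F ^ 3 * G := by
        rw [ENNReal.tsum_mul_right]
        ring

lemma tsum_sum_weights_mul_le (w f g : ℤ → ℝ≥0∞) :
    ∑' (a : ℤ) (b : ℤ) (c : ℤ),
        (w (b + c) + w (a + c) + w (a + b)) * (f a * f b * f c * g (a + b + c)) ≤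
      3 * ((∑' n, w n) * ((∑' n, f n ^ 2) ^ (1 / 2 : ℝ)) ^ 3 *
        (∑' n, g n ^ 2) ^ (1 / 2 : ℝ)) := by
  have h := tsum_weight_mul_le w f g
  have hB : ∑' (a : ℤ) (b : ℤ) (c : ℤ), w (a + c) * (f a * f b * f c * g (a + b + c)) =
      ∑' (a : ℤ) (b : ℤ) (c : ℤ), w (b + c) * (f a * f b * f c * g (a + b + c)) := by
    rw [ENNReal.tsum_comm]
    refine tsum_congr fun a => tsum_congr fun b => tsum_congr fun c => ?_
    rw [add_comm b a]
    ring
  have hC : ∑' (a : ℤ) (b : ℤ) (c : ℤ), w (a + b) * (f a * f b * f c * g (a + b + c)) =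
      ∑' (a : ℤ) (b : ℤ) (c : ℤ), w (a + c) * (f a * f b * f c * g (a + b + c)) := by
    refine tsum_congr fun a => ?_
    rw [ENNReal.tsum_comm]
    refine tsum_congr fun b => tsum_congr fun c => ?_
    rw [add_right_comm a c b]
    ring
  simp only [add_mul, ENNReal.tsum_add]
  rw [hC, hB]
  refine (add_le_add (add_le_add h h) h).trans_eq ?_
  ring

lemma l2_eq {u : ℤ → ℝ} (hu : ∀ k, 0 ≤ u k) :
    l2 u = (∑' k, ENNReal.ofReal (u k) ^ 2) ^ (1 / 2 : ℝ) := by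
  simp only [l2, ENNReal.ofReal_pow (hu _)]

lemma tsum_output_eq_tsum_inputs (F : ℤ → ℤ → ℤ → ℤ → ℝ≥0∞) :
    ∑' p : ℤ × ℤ × ℤ, F p.1 p.2.1 p.2.2 (p.1 - p.2.1 - p.2.2) =
      ∑' (a : ℤ) (b : ℤ) (c : ℤ), F (a + b + c) a b c := by
  rw [ENNReal.tsum_prod', ENNReal.tsum_comm, ENNReal.tsum_prod']
  refine tsum_congr fun a => tsum_congr fun b => ?_
  rw [← (Equiv.addLeft (a + b)).tsum_eq fun k => F k a b (k - a - b)]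
  simp [add_assoc]

/-- Weighted convolution estimate with multiplier `M₄`.
The sum runs over `(k, k₁, k₂)` with `k₃ = k - k₁ - k₂` and `Φ(k̄) ≠ 0`. -/
theorem M4_estimate :
    ∃ C > (0 : ℝ), ∀ u z : ℤ → ℝ, (∀ k, 0 ≤ u k) → (∀ k, 0 ≤ z k) →
      l2 u < ⊤ → l2 z < ⊤ →
      (∑' p : ℤ × ℤ × ℤ,
        ENNReal.ofReal
          (if Phi p.2.1 p.2.2 (p.1 - p.2.1 - p.2.2) ≠ 0 then
            M4 p.2.1 p.2.2 (p.1 - p.2.1 - p.2.2) *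
              (u p.2.1 * u p.2.2 * u (p.1 - p.2.1 - p.2.2) * z p.1)
          else 0)) ≤ ENNReal.ofReal C * l2 u ^ 3 * l2 z := by
  set w : ℤ → ℝ≥0∞ := fun n => ENNReal.ofReal (|(n : ℝ)| ^ (-(3 / 2) : ℝ))
  have hwsum : ∑' n, w n ≠ ⊤ :=
    (Real.summable_abs_int_rpow (by norm_num : (1 : ℝ) < 3 / 2)).tsum_ofReal_ne_top
  refine ⟨12 * (∑' n, w n).toReal + 1, by positivity, fun u z hu hz _ _ => ?_⟩
  rw [tsum_output_eq_tsum_inputs fun k a b c => ENNReal.ofReal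
    (if Phi a b c ≠ 0 then M4 a b c * (u a * u b * u c * z k) else 0)]
  set f : ℤ → ℝ≥0∞ := fun n => ENNReal.ofReal (u n)
  set g : ℤ → ℝ≥0∞ := fun n => ENNReal.ofReal (z n)
  have hpt : ∀ a b c : ℤ, ENNReal.ofReal
      (if Phi a b c ≠ 0 then M4 a b c * (u a * u b * u c * z (a + b + c)) else 0) ≤
      4 * ((w (b + c) + w (a + c) + w (a + b)) * (f a * f b * f c * g (a + b + c))) := by
    intro a b c
    have h1 := hu a
    have h2 := hu b
    have h3 := hu c
    have h4 := hz (a + b + c)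
    split_ifs with hΦ
    · refine (ENNReal.ofReal_le_ofReal
        (mul_le_mul_of_nonneg_right (M4_le hΦ) (by positivity))).trans_eq ?_
      rw [ENNReal.ofReal_mul (by positivity), ENNReal.ofReal_mul (by positivity),
        ENNReal.ofReal_add (by positivity) (by positivity),
        ENNReal.ofReal_add (by positivity) (by positivity),
        ENNReal.ofReal_mul (by positivity), ENNReal.ofReal_mul (by positivity),
        ENNReal.ofReal_mul (by positivity), ENNReal.ofReal_ofNat, mul_assoc]
    · simp
  rw [l2_eq hu, l2_eq hz]
  calc _ ≤ ∑' (a : ℤ) (b : ℤ) (c : ℤ),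
        4 * ((w (b + c) + w (a + c) + w (a + b)) * (f a * f b * f c * g (a + b + c))) :=
        ENNReal.tsum_le_tsum fun a => ENNReal.tsum_le_tsum fun b =>
          ENNReal.tsum_le_tsum fun c => hpt a b c
    _ ≤ 4 * (3 * ((∑' n, w n) * ((∑' n, f n ^ 2) ^ (1 / 2 : ℝ)) ^ 3 *
        (∑' n, g n ^ 2) ^ (1 / 2 : ℝ))) := by
        simp only [ENNReal.tsum_mul_left]
        gcongr
        exact tsum_sum_weights_mul_le w f g
    _ = 12 * (∑' n, w n) * ((∑' n, f n ^ 2) ^ (1 / 2 : ℝ)) ^ 3 *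
        (∑' n, g n ^ 2) ^ (1 / 2 : ℝ) := by ring
    _ ≤ _ := by
        gcongr
        rw [ENNReal.ofReal_add (by positivity) zero_le_one, ENNReal.ofReal_mul (by norm_num),
          ENNReal.ofReal_toReal hwsum, ENNReal.ofReal_ofNat]
        exact le_self_add
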